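/- For every n ≥ 0 and every A ∈ E^{n+1} \ E^n, writing A = A_1 ⊔ … ⊔ A_{j_A} as the disjoint union of the elements of E^n contained in A (the subcycles of A), at least one subcycle of A is a good singleton of A, i.e. there is a subcycle A_j = {a} such that some b ∈ S with q(a,b) > 0 satisfies H(b) ≤ H(a). -/

import Mathlib

open scoped ENNReal

namespace MetropolisCycles

variable {S : Type*} [Fintype S] [DecidableEq S]

/-- A path: a finite sequence of states whose consecutive members communicate. -/
def IsPath (q : S → S → ℝ) (ω : List S) : Prop :=
  ω.Chain' (fun a b => 0 < q a b)

/-- `x` and `y` are joined by a path entirely contained in `G`. -/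
def JoinedIn (q : S → S → ℝ) (G : Set S) (x y : S) : Prop :=
  ∃ ω : List S, ω.head? = some x ∧ ω.getLast? = some y ∧ IsPath q ω ∧ ∀ z ∈ ω, z ∈ G

/-- `G` is connected: any two of its points are joined by a path inside `G`. -/
def IsConnectedSet (q : S → S → ℝ) (G : Set S) : Prop :=
  ∀ x ∈ G, ∀ y ∈ G, JoinedIn q G x y

/-- The exterior boundary `∂G`. -/
def extBoundary (q : S → S → ℝ) (G : Set S) : Set S :=
  {y | y ∉ G ∧ ∃ x ∈ G, 0 < q x y}

/-- `A` is a non-trivial path cycle: connected and `max_A H < min_{∂A} H`. -/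
def IsNontrivialPathCycle (H : S → ℝ) (q : S → S → ℝ) (A : Set S) : Prop :=
  A.Nonempty ∧ IsConnectedSet q A ∧ ∀ x ∈ A, ∀ y ∈ extBoundary q A, H x < H y

/-- `A` is a path cycle: a singleton or a non-trivial path cycle. -/
def IsPathCycle (H : S → ℝ) (q : S → S → ℝ) (A : Set S) : Prop :=
  (∃ x, A = {x}) ∨ IsNontrivialPathCycle H q A

/-- The set of points joined to `x` by a path whose points all have energy at most `c`. -/
def energyCut (H : S → ℝ) (q : S → S → ℝ) (c : ℝ) (x : S) : Set S :=
  {y | JoinedIn q {z | H z ≤ c} x y}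

/-- `U_{≤ x}`: the points joined to `x` by a path with energies at most `H x`. -/
def Ule (H : S → ℝ) (q : S → S → ℝ) (x : S) : Set S := energyCut H q (H x) x

/-- The total cost of a path of cycles with respect to a cost function `Vs`. -/
noncomputable def listCost (Vs : Set S → Set S → ℝ≥0∞) : List (Set S) → ℝ≥0∞
  | [] => 0
  | [_] => 0
  | B :: B' :: l => Vs B B' + listCost Vs (B' :: l)

/-- `H_e` relative to a level `(E, V)` of the construction:
`H_e(A) = min { V(A,A') : A' ∈ E, A' ≠ A }`. -/
noncomputable def HeAux (E : Set (Set S)) (V : Set S → Set S → ℝ≥0∞) (A : Set S) : ℝ≥0∞ :=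
  ⨅ A' ∈ E \ {A}, V A A'

/-- The renormalized cost function `V_* (A,B) = V(A,B) - H_e(A)`. -/
noncomputable def VsAux (E : Set (Set S)) (V : Set S → Set S → ℝ≥0∞) (A B : Set S) : ℝ≥0∞ :=
  V A B - HeAux E V A

/-- `A →_k A'`: some path of elements of `E` from `A` to `A'` has zero total `V_*`-cost. -/
def arrowAux (E : Set (Set S)) (V : Set S → Set S → ℝ≥0∞) (A A' : Set S) : Prop :=
  ∃ l : List (Set S), l.head? = some A ∧ l.getLast? = some A' ∧ (∀ B ∈ l, B ∈ E) ∧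
    listCost (VsAux E V) l = 0

/-- The set `D^{k+1}`: unions of the `R_k`-equivalence classes. -/
def DAux (E : Set (Set S)) (V : Set S → Set S → ℝ≥0∞) : Set (Set S) :=
  {B | ∃ A ∈ E, B = ⋃₀ {A' | A' ∈ E ∧ arrowAux E V A A' ∧ arrowAux E V A' A}}

/-- The order relation `≥^{k+1}` on `D^{k+1}`. -/
def geqAux (E : Set (Set S)) (V : Set S → Set S → ℝ≥0∞) (B B' : Set S) : Prop :=
  ∃ C ∈ E, ∃ C' ∈ E, C ⊆ B ∧ C' ⊆ B' ∧ arrowAux E V C C'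

/-- `D_*^{k+1}`: the minimal elements of `D^{k+1}` for `≥^{k+1}`. -/
def DstarAux (E : Set (Set S)) (V : Set S → Set S → ℝ≥0∞) : Set (Set S) :=
  {B ∈ DAux E V | ∀ B' ∈ DAux E V, geqAux E V B B' → B' = B}

/-- `E^{k+1}` built from `(E^k, V^k)`. -/
def EnextAux (E : Set (Set S)) (V : Set S → Set S → ℝ≥0∞) : Set (Set S) :=
  DstarAux E V ∪ {A | A ∈ E ∧ ∃ B ∈ DAux E V \ DstarAux E V, A ⊆ B}

/-- `H_m^{k+1}(A) = max { H_e^k(A') : A' ∈ E^k, A' ⊆ A }`. -/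
noncomputable def HmAux (E : Set (Set S)) (V : Set S → Set S → ℝ≥0∞) (A : Set S) : ℝ≥0∞ :=
  ⨆ A' ∈ {A' | A' ∈ E ∧ A' ⊆ A}, HeAux E V A'

/-- `V^{k+1}(A,A') = H_m^{k+1}(A) + min { V_*^k(B,B') : B,B' ∈ E^k, B ⊆ A, B' ⊆ A' }`. -/
noncomputable def VnextAux (E : Set (Set S)) (V : Set S → Set S → ℝ≥0∞) (A A' : Set S) : ℝ≥0∞ :=
  HmAux E V A + ⨅ B ∈ {B | B ∈ E ∧ B ⊆ A}, ⨅ B' ∈ {B' | B' ∈ E ∧ B' ⊆ A'}, VsAux E V B B'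

/-- The zero-order cost function `V^0({i},{j}) = (H j - H i)⁺` if `q i j > 0`, `∞` otherwise
(and `∞` on non-singletons). -/
noncomputable def V0 (H : S → ℝ) (q : S → S → ℝ) (A B : Set S) : ℝ≥0∞ :=
  ⨅ i ∈ A, ⨅ j ∈ B, ⨅ _ : A = {i} ∧ B = {j} ∧ 0 < q i j, ENNReal.ofReal (H j - H i)

/-- The recursive construction `k ↦ (E^k, V^k)`. -/
noncomputable def cycEV (H : S → ℝ) (q : S → S → ℝ) : ℕ → Set (Set S) × (Set S → Set S → ℝ≥0∞)
  | 0 => ({A | ∃ i, A = {i}}, V0 H q)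
  | k + 1 => (EnextAux (cycEV H q k).1 (cycEV H q k).2,
              VnextAux (cycEV H q k).1 (cycEV H q k).2)

/-- The `k`-th order set of graph cycles `E^k`. -/
noncomputable def Ecyc (H : S → ℝ) (q : S → S → ℝ) (k : ℕ) : Set (Set S) := (cycEV H q k).1

/-- The `k`-th order cost function `V^k`. -/
noncomputable def Vcyc (H : S → ℝ) (q : S → S → ℝ) (k : ℕ) : Set S → Set S → ℝ≥0∞ :=
  (cycEV H q k).2

/-- `H_e^k(A)`. -/
noncomputable def Hek (H : S → ℝ) (q : S → S → ℝ) (k : ℕ) (A : Set S) : ℝ≥0∞ :=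
  HeAux (Ecyc H q k) (Vcyc H q k) A

/-- `H_m^k(A)` (defined for `k ≥ 1`; set to `0` at `k = 0`). -/
noncomputable def Hmk (H : S → ℝ) (q : S → S → ℝ) : ℕ → Set S → ℝ≥0∞
  | 0 => fun _ => 0
  | k + 1 => fun A => HmAux (Ecyc H q k) (Vcyc H q k) A

/-- `D^{n+1}` (indexed by `n`). -/
noncomputable def Dcyc (H : S → ℝ) (q : S → S → ℝ) (n : ℕ) : Set (Set S) :=
  DAux (Ecyc H q n) (Vcyc H q n)

/-- `D_*^{n+1}` (indexed by `n`). -/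
noncomputable def DstarCyc (H : S → ℝ) (q : S → S → ℝ) (n : ℕ) : Set (Set S) :=
  DstarAux (Ecyc H q n) (Vcyc H q n)

/-- The set of graph cycles `C = ∪_k E^k`. -/
def GraphCycles (H : S → ℝ) (q : S → S → ℝ) : Set (Set S) := {A | ∃ k, A ∈ Ecyc H q k}

/-- `H_e(A) = sup { H_e^k(A) : k ≥ 0, A ∈ E^k }` (for a graph cycle `A ≠ S`). -/
noncomputable def HeC (H : S → ℝ) (q : S → S → ℝ) (A : Set S) : ℝ≥0∞ :=
  ⨆ k, ⨆ _ : A ∈ Ecyc H q k, Hek H q k A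

/-- `H_m(A) = max( sup { H_e(B) : B ∈ C, B ⊆ A, B ≠ A }, 0 )` (for `|A| > 1`). -/
noncomputable def HmC (H : S → ℝ) (q : S → S → ℝ) (A : Set S) : ℝ≥0∞ :=
  ⨆ B ∈ {B | B ∈ GraphCycles H q ∧ B ⊆ A ∧ B ≠ A}, HeC H q B

section

variable {T : Type*}

/-- The lowest saddle height over the edges between `A` and `B`. -/
noncomputable def saddle (h : T → ℝ≥0∞) (q : T → T → ℝ) (A B : Set T) : ℝ≥0∞ :=
  ⨅ x ∈ A, ⨅ y ∈ B, ⨅ _ : 0 < q x y, max (h x) (h y)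

/-- The lowest saddle height between `A` and another element of `E`. -/
noncomputable def exitHeight (h : T → ℝ≥0∞) (q : T → T → ℝ) (E : Set (Set T)) (A : Set T) :
    ℝ≥0∞ :=
  ⨅ B ∈ E \ {A}, saddle h q A B

/-- The invariant of the cycle decomposition: `E` is a partition, the costs are saddle heights
up to an additive constant depending on the source only, and the non-singleton elements of `E`
lie strictly below their exterior boundary. -/
structure CycleInvariant (h : T → ℝ≥0∞) (q : T → T → ℝ) (E : Set (Set T))
    (V : Set T → Set T → ℝ≥0∞) : Prop where
  nonempty : ∀ A ∈ E, A.Nonempty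
  cover : ∀ x, ∃ A ∈ E, x ∈ A
  disj : ∀ A ∈ E, ∀ B ∈ E, ∀ x, x ∈ A → x ∈ B → A = B
  cost : ∀ A ∈ E, ∃ c : ℝ≥0∞, c ≠ ∞ ∧ ∀ B ∈ E, B ≠ A → V A B + c = saddle h q A B
  height : ∀ A ∈ E, (∃ x, A = {x}) ∨
    ∀ x ∈ A, ∀ x' ∈ A, ∀ y, y ∉ A → 0 < q x' y → h x < h y

/-- A single step of zero renormalized cost. -/
def ZeroStep (E : Set (Set T)) (V : Set T → Set T → ℝ≥0∞) (A B : Set T) : Prop :=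
  A ∈ E ∧ B ∈ E ∧ VsAux E V A B = 0

variable {h : T → ℝ≥0∞} {q : T → T → ℝ} {E : Set (Set T)} {V : Set T → Set T → ℝ≥0∞}
  {A B C : Set T}

theorem saddle_le {x y : T} (hx : x ∈ A) (hy : y ∈ B) (hxy : 0 < q x y) :
    saddle h q A B ≤ max (h x) (h y) :=
  iInf₂_le_of_le x hx <| iInf₂_le_of_le y hy <| iInf_le _ hxy

theorem le_saddle_iff {t : ℝ≥0∞} :
    t ≤ saddle h q A B ↔ ∀ x ∈ A, ∀ y ∈ B, 0 < q x y → t ≤ max (h x) (h y) := by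
  simp only [saddle, le_iInf_iff]

theorem exists_edge_of_saddle_ne_top (hs : saddle h q A B ≠ ∞) :
    ∃ x ∈ A, ∃ y ∈ B, 0 < q x y := by
  contrapose! hs
  refine top_le_iff.1 (le_saddle_iff.2 fun x hx y hy hxy => ?_)
  exact absurd hxy (not_lt.2 (hs x hx y hy))

theorem saddle_comm (hsym : ∀ x y, q x y = q y x) : saddle h q A B = saddle h q B A := by
  refine le_antisymm ?_ ?_ <;>
  · refine le_saddle_iff.2 fun x hx y hy hxy => ?_
    rw [max_comm]
    exact saddle_le hy hx (hsym x y ▸ hxy)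

theorem exitHeight_le (hB : B ∈ E) (hBA : B ≠ A) : exitHeight h q E A ≤ saddle h q A B :=
  iInf₂_le B ⟨hB, hBA⟩

theorem HeAux_le (hB : B ∈ E) (hBA : B ≠ A) : HeAux E V A ≤ V A B :=
  iInf₂_le B ⟨hB, hBA⟩

theorem arrowAux_iff :
    arrowAux E V A B ↔ A ∈ E ∧ B ∈ E ∧ Relation.ReflTransGen (ZeroStep E V) A B := by
  constructor
  · rintro ⟨l, hA, hB, hl, hc⟩
    refine ⟨hl _ (List.mem_of_head? hA), hl _ (List.mem_of_getLast? hB), ?_⟩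
    induction l generalizing A with
    | nil => simp at hA
    | cons C l ih =>
      obtain rfl : C = A := by simpa using hA
      cases l with
      | nil =>
        obtain rfl : C = B := by simpa using hB
        exact .refl
      | cons D l =>
        simp only [listCost, add_eq_zero] at hc
        have hstep : ZeroStep E V C D := ⟨hl _ (by simp), hl _ (by simp), hc.1⟩
        exact .head hstep (ih (by simp) (by simpa using hB)
          (fun F hF => hl F (List.mem_cons_of_mem _ hF)) hc.2)
  · rintro ⟨hA, hB, hAB⟩
    induction hAB using Relation.ReflTransGen.head_induction_on with
    | refl => exact ⟨[B], by simp, by simp, by simpa using hB, rfl⟩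
    | head hstep _ ih =>
      obtain ⟨l, h1, h2, h3, h4⟩ := ih hstep.2.1
      cases l with
      | nil => simp at h1
      | cons D l =>
        obtain rfl : D = _ := by simpa using h1
        refine ⟨_ :: D :: l, rfl, by simpa using h2, ?_, ?_⟩
        · simpa using ⟨hA, by simpa using h3⟩
        · simp [listCost, h4, hstep.2.2]

theorem arrowAux.trans (h₁ : arrowAux E V A B) (h₂ : arrowAux E V B C) : arrowAux E V A C := by
  rw [arrowAux_iff] at *
  exact ⟨h₁.1, h₂.2.1, h₁.2.2.trans h₂.2.2⟩

theorem arrowAux_refl (hA : A ∈ E) : arrowAux E V A A := arrowAux_iff.2 ⟨hA, hA, .refl⟩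

theorem ZeroStep.arrowAux (hs : ZeroStep E V A B) : arrowAux E V A B :=
  arrowAux_iff.2 ⟨hs.1, hs.2.1, .single hs⟩

/-- The union of the class of `A`. -/
def classUnion (E : Set (Set T)) (V : Set T → Set T → ℝ≥0∞) (A : Set T) : Set T :=
  ⋃₀ {A' | A' ∈ E ∧ arrowAux E V A A' ∧ arrowAux E V A' A}

theorem classUnion_mem (hA : A ∈ E) : classUnion E V A ∈ DAux E V := ⟨A, hA, rfl⟩

theorem subset_classUnion (hA : A ∈ E) : A ⊆ classUnion E V A :=
  Set.subset_sUnion_of_mem ⟨hA, arrowAux_refl hA, arrowAux_refl hA⟩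

theorem classUnion_eq (h₁ : arrowAux E V A B) (h₂ : arrowAux E V B A) :
    classUnion E V A = classUnion E V B := by
  unfold classUnion
  congr 1
  ext C
  exact ⟨fun h => ⟨h.1, h₂.trans h.2.1, h.2.2.trans h₁⟩,
    fun h => ⟨h.1, h₁.trans h.2.1, h.2.2.trans h₂⟩⟩

theorem ZeroStep.subset (hs : ZeroStep E V B C) (hA : A ∈ DstarAux E V) (hBA : B ⊆ A) : C ⊆ A := by
  have := hA.2 _ (classUnion_mem hs.2.1)
    ⟨B, hs.1, C, hs.2.1, hBA, subset_classUnion hs.2.1, hs.arrowAux⟩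
  exact this ▸ subset_classUnion hs.2.1

namespace CycleInvariant

theorem eq_of_subset (hI : CycleInvariant h q E V) (hA : A ∈ E) (hB : B ∈ E) (hAB : A ⊆ B) :
    A = B := by
  obtain ⟨x, hx⟩ := hI.nonempty A hA
  exact hI.disj A hA B hB x hx (hAB hx)

theorem arrows_of_subset_classUnion (hI : CycleInvariant h q E V) (hB : B ∈ E)
    (hBA : B ⊆ classUnion E V A) : arrowAux E V A B ∧ arrowAux E V B A := by
  obtain ⟨x, hx⟩ := hI.nonempty B hB
  obtain ⟨C, ⟨hC, hAC⟩, hxC⟩ := hBA hx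
  obtain rfl := hI.disj B hB C hC x hx hxC
  exact hAC

theorem DAux_disj (hI : CycleInvariant h q E V) {D D' : Set T} (hD : D ∈ DAux E V)
    (hD' : D' ∈ DAux E V) {x : T} (hx : x ∈ D) (hx' : x ∈ D') : D = D' := by
  obtain ⟨A, hA, rfl⟩ := hD
  obtain ⟨A', hA', rfl⟩ := hD'
  obtain ⟨B, ⟨hB, h1, h2⟩, hxB⟩ := hx
  obtain ⟨B', ⟨hB', h1', h2'⟩, hxB'⟩ := hx'
  obtain rfl := hI.disj B hB B' hB' x hxB hxB'
  exact classUnion_eq (h1.trans h2') (h1'.trans h2)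

theorem exists_cost (hI : CycleInvariant h q E V) (hA : A ∈ E) :
    ∃ c : ℝ≥0∞, c ≠ ∞ ∧ HeAux E V A + c = exitHeight h q E A ∧
      ∀ B ∈ E, B ≠ A → V A B + c = saddle h q A B := by
  obtain ⟨c, hc, hV⟩ := hI.cost A hA
  refine ⟨c, hc, ?_, hV⟩
  simp only [HeAux, exitHeight, ENNReal.iInf_add]
  exact iInf_congr fun B => iInf_congr fun hB => hV B hB.1 hB.2

theorem zeroStep_iff (hI : CycleInvariant h q E V) (hA : A ∈ E) (hB : B ∈ E) (hBA : B ≠ A) :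
    ZeroStep E V A B ↔ saddle h q A B ≤ exitHeight h q E A := by
  obtain ⟨c, hc, he, hV⟩ := hI.exists_cost hA
  rw [← he, ← hV B hB hBA, ENNReal.add_le_add_iff_right hc]
  simp [ZeroStep, VsAux, hA, hB, tsub_eq_zero_iff_le]

theorem exitHeight_le_of_arrow (hI : CycleInvariant h q E V) (hsym : ∀ x y, q x y = q y x)
    (hAB : arrowAux E V A B) : exitHeight h q E B ≤ exitHeight h q E A := by
  obtain ⟨-, -, hr⟩ := arrowAux_iff.1 hAB
  induction hr with
  | refl => exact le_rfl
  | @tail C D _ hs ih =>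
    by_cases hDC : D = C
    · subst hDC
      exact ih (arrowAux_iff.2 ⟨(arrowAux_iff.1 hAB).1, hs.1, by assumption⟩)
    · calc exitHeight h q E D ≤ saddle h q D C := exitHeight_le hs.1 (Ne.symm hDC)
        _ = saddle h q C D := saddle_comm hsym
        _ ≤ exitHeight h q E C := (hI.zeroStep_iff hs.1 hs.2.1 hDC).1 hs
        _ ≤ exitHeight h q E A :=
          ih (arrowAux_iff.2 ⟨(arrowAux_iff.1 hAB).1, hs.1, by assumption⟩)

/-- Elements of the next level are unions of elements of `E` with a common exit height. -/
theorem exists_common_exitHeight (hI : CycleInvariant h q E V)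
    (hsym : ∀ x y, q x y = q y x) (hA : A ∈ EnextAux E V) :
    ∃ e, (∀ B ∈ E, B ⊆ A → exitHeight h q E B = e) ∧ (∃ B ∈ E, B ⊆ A) ∧
      ∀ x ∈ A, ∃ B ∈ E, B ⊆ A ∧ x ∈ B := by
  rcases hA with ⟨⟨A₀, hA₀, rfl⟩, -⟩ | ⟨hA, -⟩
  · refine ⟨exitHeight h q E A₀, fun B hB hBA => ?_, ⟨A₀, hA₀, subset_classUnion hA₀⟩, ?_⟩
    · obtain ⟨h1, h2⟩ := hI.arrows_of_subset_classUnion hB hBA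
      exact le_antisymm (hI.exitHeight_le_of_arrow hsym h1) (hI.exitHeight_le_of_arrow hsym h2)
    · rintro x ⟨B, hB, hx⟩
      exact ⟨B, hB.1, Set.subset_sUnion_of_mem hB, hx⟩
  · refine ⟨exitHeight h q E A, fun B hB hBA => ?_, ⟨A, hA, subset_rfl⟩,
      fun x hx => ⟨A, hA, subset_rfl, hx⟩⟩
    rw [hI.eq_of_subset hB hA hBA]

theorem le_exitHeight (hI : CycleInvariant h q E V) (hA : A ∈ E) {x : T} (hx : x ∈ A) :
    h x ≤ exitHeight h q E A := by
  refine le_iInf₂ fun B hB => le_saddle_iff.2 fun u hu v hv huv => ?_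
  rcases hI.height A hA with ⟨z, rfl⟩ | hh
  · obtain rfl : x = z := hx
    obtain rfl : u = x := hu
    exact le_max_left _ _
  · refine (hh x hx u hu v (fun hvA => hB.2 ?_) huv).le.trans (le_max_right _ _)
    exact hI.disj B hB.1 A hA v hv hvA

theorem height_of_mem_DstarAux (hI : CycleInvariant h q E V) (hsym : ∀ x y, q x y = q y x)
    (hA : A ∈ DstarAux E V) : ∀ x ∈ A, ∀ x' ∈ A, ∀ y, y ∉ A → 0 < q x' y → h x < h y := by
  intro x hx x' hx' y hy hxy
  obtain ⟨e, he, -, hcov⟩ := hI.exists_common_exitHeight hsym (Or.inl hA)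
  obtain ⟨B, hB, hBA, hxB⟩ := hcov x hx
  obtain ⟨B', hB', hBA', hxB'⟩ := hcov x' hx'
  obtain ⟨C, hC, hyC⟩ := hI.cover y
  have hCA : ¬ C ⊆ A := fun hCA => hy (hCA hyC)
  have hCB : C ≠ B' := by rintro rfl; exact hCA hBA'
  have h1 : e < saddle h q B' C := by
    rw [← he B' hB' hBA', ← not_le, ← hI.zeroStep_iff hB' hC hCB]
    exact fun hs => hCA (hs.subset hA hBA')
  have h2 := h1.trans_le (saddle_le hxB' hyC hxy)
  have h3 : h x ≤ e := he B hB hBA ▸ hI.le_exitHeight hB hxB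
  have h4 : h x' ≤ e := he B' hB' hBA' ▸ hI.le_exitHeight hB' hxB'
  exact h3.trans_lt ((lt_max_iff.1 h2).resolve_left h4.not_gt)

theorem disj_EnextAux (hI : CycleInvariant h q E V) (hA : A ∈ EnextAux E V)
    (hB : B ∈ EnextAux E V) {x : T} (hxA : x ∈ A) (hxB : x ∈ B) : A = B := by
  rcases hA with hA | ⟨hA, D, hD, hAD⟩ <;> rcases hB with hB | ⟨hB, D', hD', hBD⟩
  · exact hI.DAux_disj hA.1 hB.1 hxA hxB
  · exact absurd (hI.DAux_disj hA.1 hD'.1 hxA (hBD hxB) ▸ hA) hD'.2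
  · exact absurd (hI.DAux_disj hB.1 hD.1 hxB (hAD hxA) ▸ hB) hD.2
  · exact hI.disj A hA B hB x hxA hxB

theorem cost_VnextAux [Finite T] (hI : CycleInvariant h q E V) (hsym : ∀ x y, q x y = q y x)
    (hA : A ∈ EnextAux E V) : ∃ c : ℝ≥0∞, c ≠ ∞ ∧
      ∀ B ∈ EnextAux E V, B ≠ A → VnextAux E V A B + c = saddle h q A B := by
  obtain ⟨e, he, ⟨B₁, hB₁, hB₁A⟩, hcov⟩ := hI.exists_common_exitHeight hsym hA
  choose! c hc hHe hV using fun B (hB : B ∈ E) => hI.exists_cost hB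
  obtain ⟨B₀, ⟨hB₀, hB₀A⟩, hmin⟩ := Set.exists_min_image {B | B ∈ E ∧ B ⊆ A} c
    (Set.toFinite _) ⟨B₁, hB₁, hB₁A⟩
  have hHm : HmAux E V A = HeAux E V B₀ := by
    refine le_antisymm (iSup₂_le fun B hB => ?_)
      (le_iSup₂_of_le (f := fun B _ => HeAux E V B) B₀ ⟨hB₀, hB₀A⟩ le_rfl)
    rw [← ENNReal.add_le_add_iff_right (hc B₀ hB₀), hHe B₀ hB₀, he B₀ hB₀ hB₀A,
      ← he B hB.1 hB.2, ← hHe B hB.1]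
    gcongr
    exact hmin B hB
  refine ⟨c B₀, hc B₀ hB₀, fun A' hA' hne => ?_⟩
  have hstep : ∀ B ∈ E, B ⊆ A → ∀ B' ∈ E, B' ⊆ A' →
      VsAux E V B B' + e = saddle h q B B' := by
    intro B hB hBA B' hB' hBA'
    have hBB : B' ≠ B := by
      rintro rfl
      obtain ⟨x, hx⟩ := hI.nonempty B' hB'
      exact hne (hI.disj_EnextAux hA' hA (hBA' hx) (hBA hx))
    rw [VsAux, ← he B hB hBA, ← hHe B hB, ← add_assoc,
      tsub_add_cancel_of_le (HeAux_le hB' hBB), hV B hB B' hB' hBB]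
  obtain ⟨-, -, -, hcov'⟩ := hI.exists_common_exitHeight hsym hA'
  rw [VnextAux, hHm, add_right_comm, hHe B₀ hB₀, he B₀ hB₀ hB₀A, add_comm]
  simp only [ENNReal.iInf_add]
  refine le_antisymm (le_saddle_iff.2 fun x hx y hy hxy => ?_) ?_
  · obtain ⟨B, hB, hBA, hxB⟩ := hcov x hx
    obtain ⟨B', hB', hBA', hyB'⟩ := hcov' y hy
    refine iInf₂_le_of_le B ⟨hB, hBA⟩ (iInf₂_le_of_le B' ⟨hB', hBA'⟩ ?_)
    rw [hstep B hB hBA B' hB' hBA']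
    exact saddle_le hxB hyB' hxy
  · refine le_iInf₂ fun B hB => le_iInf₂ fun B' hB' => ?_
    rw [hstep B hB.1 hB.2 B' hB'.1 hB'.2]
    exact le_saddle_iff.2 fun x hx y hy hxy => saddle_le (hB.2 hx) (hB'.2 hy) hxy

theorem next [Finite T] (hI : CycleInvariant h q E V) (hsym : ∀ x y, q x y = q y x) :
    CycleInvariant h q (EnextAux E V) (VnextAux E V) where
  nonempty A hA := by
    obtain ⟨-, -, ⟨B, hB, hBA⟩, -⟩ := hI.exists_common_exitHeight hsym hA
    exact (hI.nonempty B hB).mono hBA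
  cover x := by
    obtain ⟨A, hA, hx⟩ := hI.cover x
    by_cases hD : classUnion E V A ∈ DstarAux E V
    · exact ⟨_, Or.inl hD, subset_classUnion hA hx⟩
    · exact ⟨A, Or.inr ⟨hA, _, ⟨classUnion_mem hA, hD⟩, subset_classUnion hA⟩, hx⟩
  disj A hA B hB x := hI.disj_EnextAux hA hB
  cost A hA := hI.cost_VnextAux hsym hA
  height A hA := by
    rcases hA with hA | hA
    · exact Or.inr (hI.height_of_mem_DstarAux hsym hA)
    · exact hI.height A hA.1

/-- A new cycle contains two adjacent elements of the previous level. -/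
theorem exists_edge_of_notMem (hI : CycleInvariant h q E V) (hh : ∀ x, h x ≠ ∞)
    (hexit : ∀ G : Set T, G.Nonempty → G ≠ Set.univ → ∃ x ∈ G, ∃ y, y ∉ G ∧ 0 < q x y)
    (hA : A ∈ EnextAux E V) (hAE : A ∉ E) :
    ∃ B ∈ E, ∃ C ∈ E, B ⊆ A ∧ C ⊆ A ∧ B ≠ C ∧ ∃ x ∈ B, ∃ y ∈ C, 0 < q x y := by
  have hD : A ∈ DstarAux E V := hA.resolve_right fun hA => hAE hA.1
  obtain ⟨B, hB, hAB⟩ := hD.1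
  change A = classUnion E V B at hAB
  have hBA : B ⊆ A := hAB ▸ subset_classUnion hB
  obtain ⟨B', hB'A, hB', hBB'⟩ : ∃ B', B' ⊆ A ∧ arrowAux E V B B' ∧ B ≠ B' := by
    by_contra! hcon
    refine hAE ?_
    have : A = B := by
      refine subset_antisymm (hAB ▸ Set.sUnion_subset fun C hC => ?_) hBA
      exact (hcon C (hAB ▸ Set.subset_sUnion_of_mem hC) hC.2.1).ge
    exact this ▸ hB
  obtain ⟨C, hs, hCB⟩ : ∃ C, ZeroStep E V B C ∧ C ≠ B := by
    obtain ⟨-, -, hr⟩ := arrowAux_iff.1 hB'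
    by_contra! hcon
    refine hBB' ?_
    clear hBB' hB' hB'A
    induction hr with
    | refl => rfl
    | tail _ hs ih => exact (hcon _ (ih ▸ hs)).symm
  refine ⟨B, hB, C, hs.2.1, hBA, hs.subset hD hBA, hCB.symm, ?_⟩
  obtain ⟨x, hx, y, hy, hxy⟩ := hexit B (hI.nonempty B hB) (by
    rintro rfl
    exact hCB (hI.eq_of_subset hs.2.1 hB (Set.subset_univ _)))
  obtain ⟨F, hF, hyF⟩ := hI.cover y
  have hFB : F ≠ B := by rintro rfl; exact hy hyF
  apply exists_edge_of_saddle_ne_top (h := h)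
  refine ne_top_of_le_ne_top (max_lt (hh x).lt_top (hh y).lt_top).ne ?_
  calc saddle h q B C ≤ exitHeight h q E B := (hI.zeroStep_iff hB hs.2.1 hCB).1 hs
    _ ≤ saddle h q B F := exitHeight_le hF hFB
    _ ≤ max (h x) (h y) := saddle_le hx hyF hxy

end CycleInvariant

theorem exists_exit_edge (hirr : ∀ x y : T, JoinedIn q Set.univ x y) {G : Set T}
    (hG : G.Nonempty) (hG' : G ≠ Set.univ) : ∃ x ∈ G, ∃ y, y ∉ G ∧ 0 < q x y := by
  obtain ⟨a, ha⟩ := hG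
  obtain ⟨b, hb⟩ := (Set.ne_univ_iff_exists_notMem G).1 hG'
  obtain ⟨l, hla, hlb, hl, -⟩ := hirr a b
  unfold IsPath at hl
  induction l generalizing a with
  | nil => simp at hla
  | cons x l ih =>
    obtain rfl : x = a := by simpa using hla
    cases l with
    | nil =>
      obtain rfl : x = b := by simpa using hlb
      exact absurd ha hb
    | cons y l =>
      obtain ⟨hxy, hl⟩ := List.isChain_cons_cons.1 hl
      by_cases hy : y ∈ G
      · exact ih y hy (by simp) (by simpa using hlb) hl
      · exact ⟨x, ha, y, hy, hxy⟩

theorem cycleInvariant_zero {H : T → ℝ} {M : ℝ} (hM : ∀ x, M ≤ H x) :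
    CycleInvariant (fun x => ENNReal.ofReal (H x - M)) q {A | ∃ i, A = {i}} (V0 H q) where
  nonempty := by rintro _ ⟨i, rfl⟩; simp
  cover x := ⟨{x}, ⟨x, rfl⟩, rfl⟩
  disj := by rintro _ ⟨i, rfl⟩ _ ⟨j, rfl⟩ x hi hj; rw [← hi, ← hj]
  cost := by
    rintro _ ⟨i, rfl⟩
    refine ⟨ENNReal.ofReal (H i - M), ENNReal.ofReal_ne_top, ?_⟩
    rintro _ ⟨j, rfl⟩ -
    simp only [V0, saddle, Set.mem_singleton_iff, iInf_iInf_eq_left, true_and]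
    rw [ENNReal.iInf_add]
    refine iInf_congr fun _ => ?_
    rcases le_total (H i) (H j) with hij | hij
    · rw [← ENNReal.ofReal_add (by linarith) (by linarith [hM i]),
        max_eq_right (ENNReal.ofReal_le_ofReal (by linarith))]
      congr 1
      ring
    · rw [ENNReal.ofReal_of_nonpos (by linarith), zero_add,
        max_eq_left (ENNReal.ofReal_le_ofReal (by linarith))]
  height := by rintro _ ⟨i, rfl⟩; exact Or.inl ⟨i, rfl⟩

theorem cycleInvariant_cyc [Finite T] {H : T → ℝ} {M : ℝ} (hM : ∀ x, M ≤ H x)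
    (hsym : ∀ x y, q x y = q y x) (n : ℕ) :
    CycleInvariant (fun x => ENNReal.ofReal (H x - M)) q (Ecyc H q n) (Vcyc H q n) := by
  induction n with
  | zero => exact cycleInvariant_zero hM
  | succ n ih => exact ih.next hsym

end

/-- For every `n ≥ 0` and `A ∈ E^{n+1} \ E^n`, at least one subcycle of `A` (element of
`E^n` contained in `A`) is a good singleton of `A`: a singleton `{a}` having a neighbor
`b` with `H b ≤ H a`. -/
theorem exists_good_singleton (H : S → ℝ) (q : S → S → ℝ)
    (hq : ∀ x y : S, 0 ≤ q x y ∧ q x y ≤ 1)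
    (hsum : ∀ x : S, ∑ y ∈ Finset.univ.erase x, q x y ≤ 1)
    (hsym : ∀ x y : S, q x y = q y x)
    (hirr : ∀ x y : S, JoinedIn q Set.univ x y)
    (n : ℕ) (A : Set S) (hA : A ∈ Ecyc H q (n + 1)) (hA' : A ∉ Ecyc H q n) :
    ∃ a : S, ({a} : Set S) ∈ Ecyc H q n ∧ a ∈ A ∧ ∃ b : S, 0 < q a b ∧ H b ≤ H a := by
  obtain ⟨M, hM⟩ := (Set.finite_range H).bddBelow
  have hM' : ∀ x, M ≤ H x := fun x => hM ⟨x, rfl⟩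
  have hI := cycleInvariant_cyc hM' hsym n
  obtain ⟨B, hB, C, hC, hBA, hCA, hBC, x, hx, y, hy, hxy⟩ :=
    hI.exists_edge_of_notMem (fun _ => ENNReal.ofReal_ne_top)
      (fun G => exists_exit_edge hirr) hA hA'
  by_contra! hcon
  have key : ∀ B ∈ Ecyc H q n, ∀ C ∈ Ecyc H q n, B ⊆ A → B ≠ C → ∀ x ∈ B, ∀ y ∈ C,
      0 < q x y → H x < H y := by
    intro B hB C hC hBA hBC x hx y hy hxy
    rcases hI.height B hB with ⟨a, rfl⟩ | hlt
    · obtain rfl : x = a := hx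
      exact hcon x hB (hBA rfl) y hxy
    · have := hlt x hx x hx y (fun hyB => hBC (hI.disj B hB C hC y hyB hy)) hxy
      have := (ENNReal.ofReal_lt_ofReal_iff_of_nonneg (by linarith [hM' x])).1 this
      linarith
  exact (key B hB C hC hBA hBC x hx y hy hxy).not_gt
    (key C hC B hB hCA hBC.symm y hy x hx (hsym x y ▸ hxy))

end MetropolisCycles
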